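/- Let S be a finite semigroup with S² = S that satisfies x² = x³ and xyx = xyxyx for all x, y ∈ S. Then the following are equivalent: (a) S satisfies the identity xyxzx = xzxyx for all x, y, z ∈ S; (b) there do not exist two distinct idempotents e, i ∈ S with eie = e and iei = i that have a common unit in S, i.e. an idempotent f ∈ S with ef = e = fe and if = i = fi. -/

import Mathlib

universe u

/-- Product of a list of semigroup elements, computed in `WithOne S`
(the empty list gives `1`). -/
def listSProd {S : Type u} [Semigroup S] (l : List S) : WithOne S :=
  (l.map (fun a => (a : WithOne S))).prod

/-- `SPow S m` : the set of elements of `S` that are products of `m` or more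
elements of `S`. -/
def SPow (S : Type u) [Semigroup S] (m : ℕ) : Set S :=
  {x | ∃ l : List S, m ≤ l.length ∧ listSProd l = (x : WithOne S)}

/-- `SES S` : the set of elements of the form `x * e * y` with `e` idempotent. -/
def SES (S : Type u) [Semigroup S] : Set S :=
  {s | ∃ x e y : S, e * e = e ∧ s = x * e * y}

/-- positive powers in a semigroup: `ppow a k = a ^ (k+1)`. -/
def ppow {S : Type u} [Semigroup S] (a : S) : ℕ → S
  | 0 => a
  | k + 1 => ppow a k * a

/-- `u` and `v` have the same set of factors (contiguous subwords) of length `k`. -/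
def SameFactors {α : Type u} (k : ℕ) (u v : List α) : Prop :=
  ∀ x : List α, x.length = k →
    ((∃ p q : List α, u = p ++ x ++ q) ↔ (∃ p q : List α, v = p ++ x ++ q))

/-- `φ` identifies any two nonempty words with the same prefix of length `ps`,
the same suffix of length `ps` and the same set of factors of length `k`. -/
def TestableFor {α S : Type u} [Semigroup S] (ps k : ℕ) (φ : List α → S) : Prop :=
  ∀ u v : List α, u ≠ [] → v ≠ [] →
    u.take ps = v.take ps →
    u.drop (u.length - ps) = v.drop (v.length - ps) →
    SameFactors k u v →
    φ u = φ v

/-- `φ : List α → S` is a semigroup homomorphism from the free semigroup of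
nonempty words over `α` to `S`. -/
def IsSgHom {α S : Type u} [Semigroup S] (φ : List α → S) : Prop :=
  ∀ u v : List α, u ≠ [] → v ≠ [] → φ (u ++ v) = φ u * φ v

/-- `φ` is surjective on nonempty words. -/
def SurjOnWords {α S : Type u} (φ : List α → S) : Prop :=
  ∀ s : S, ∃ u : List α, u ≠ [] ∧ φ u = s

/-- `S` is `k`-testable. -/
def IsKTestable (S : Type u) [Semigroup S] (k : ℕ) : Prop :=
  ∃ (α : Type u) (φ : List α → S), IsSgHom φ ∧ SurjOnWords φ ∧ TestableFor k k φ

/-- `S` is `k`-testable in the sense of Brzozowski–Simon. -/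
def IsKTestableBS (S : Type u) [Semigroup S] (k : ℕ) : Prop :=
  ∃ (α : Type u) (φ : List α → S), IsSgHom φ ∧ SurjOnWords φ ∧ TestableFor (k - 1) k φ

/-- `S` is locally testable. -/
def LocallyTestable (S : Type u) [Semigroup S] : Prop :=
  ∃ k : ℕ, 1 ≤ k ∧ IsKTestable S k

/-- The identities (2) for parameter `n`. -/
def Ident2 (S : Type u) [Semigroup S] (n : ℕ) : Prop :=
  ∀ r : ℕ, 1 ≤ r → r ≤ n → ∀ x : Fin r → S,
    listSProd (List.ofFn x) ^ ((n - (n - 1) % r - 1) / r + 1)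
        * listSProd ((List.ofFn x).take ((n - 1) % r))
      = listSProd (List.ofFn x) ^ ((n - (n - 1) % r - 1) / r + 2)
        * listSProd ((List.ofFn x).take ((n - 1) % r))

/-- The identity (3) for parameter `n`. -/
def Ident3 (S : Type u) [Semigroup S] (n : ℕ) : Prop :=
  ∀ (t₁ t₂ y z : S) (x : Fin (n - 1) → S),
    (t₁ : WithOne S) * listSProd (List.ofFn x) * y * listSProd (List.ofFn x) * z
        * listSProd (List.ofFn x) * t₂
      = (t₁ : WithOne S) * listSProd (List.ofFn x) * z * listSProd (List.ofFn x) * y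
        * listSProd (List.ofFn x) * t₂

/-- The identity (4) for parameter `n`. -/
def Ident4 (S : Type u) [Semigroup S] (n : ℕ) : Prop :=
  ∀ (y z : S) (x : Fin (n - 1) → S),
    listSProd (List.ofFn x) * y * listSProd (List.ofFn x) * z * listSProd (List.ofFn x)
      = listSProd (List.ofFn x) * z * listSProd (List.ofFn x) * y * listSProd (List.ofFn x)

theorem exists_coe_eq_listSProd {S : Type u} [Semigroup S] (l : List S) (hl : l ≠ []) :
    ∃ s : S, listSProd l = (s : WithOne S) := by
  induction l with
  | nil => exact absurd rfl hl
  | cons a t ih =>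
    by_cases ht : t = []
    · exact ⟨a, by simp [listSProd, ht]⟩
    · obtain ⟨s, hs⟩ := ih ht
      refine ⟨a * s, ?_⟩
      rw [WithOne.coe_mul, ← hs]
      simp [listSProd]

/-- A product of at least two elements is a product of exactly two elements. -/
theorem exists_eq_mul_of_mem_SPow_two {S : Type u} [Semigroup S] {x : S}
    (hx : x ∈ SPow S 2) : ∃ a b : S, x = a * b := by
  obtain ⟨l, hl, h⟩ := hx
  match l, hl with
  | a :: b :: t, _ =>
    obtain ⟨s, hs⟩ := exists_coe_eq_listSProd (b :: t) (List.cons_ne_nil b t)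
    refine ⟨a, s, WithOne.coe_injective ?_⟩
    rw [WithOne.coe_mul, ← hs, ← h]
    simp [listSProd]

theorem exists_iterate_eq_iterate_mul {S : Type u} [Semigroup S] {l r : S → S}
    (h : ∀ x, x = l x * r x) (x : S) (m k : ℕ) :
    ∃ w : S, l^[m] x = l^[m + k + 1] x * w := by
  induction k with
  | zero =>
    refine ⟨r (l^[m] x), ?_⟩
    rw [Nat.add_zero, Function.iterate_succ_apply']
    exact h _
  | succ k ih =>
    obtain ⟨w, hw⟩ := ih
    refine ⟨r (l^[m + k + 1] x) * w, ?_⟩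
    rw [← mul_assoc, ← Nat.add_assoc m k 1, Function.iterate_succ_apply' l (m + k + 1), ← h]
    exact hw

/-- In a finite semigroup in which every element is a product and all squares are idempotent,
every element has an idempotent factor. -/
theorem SES_eq_univ {S : Type u} [Semigroup S] [Finite S]
    (hS : ∀ x : S, ∃ a b : S, x = a * b) (hxx : ∀ x : S, x * x = x * x * x) :
    SES S = Set.univ := by
  refine Set.eq_univ_of_forall fun x => ?_
  choose l r h using hS
  obtain ⟨m, n, hmn, heq⟩ :=
    Set.finite_univ.exists_lt_map_eq_of_forall_mem (f := fun n : ℕ => l^[n] x)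
      (fun _ => Set.mem_univ _)
  obtain ⟨k, rfl⟩ := Nat.exists_eq_add_of_lt hmn
  obtain ⟨w, hw⟩ := exists_iterate_eq_iterate_mul h x m k
  have huw : l^[m] x = l^[m] x * w := hw.trans (congrArg (· * w) heq.symm)
  have hfix : l^[m] x = l^[m] x * (w * w) := by rw [← mul_assoc, ← huw, ← huw]
  have hidem : w * w * (w * w) = w * w := by rw [← mul_assoc, ← hxx, ← hxx]
  cases m with
  | zero =>
    refine ⟨x, w * w, w * w, hidem, ?_⟩
    rw [mul_assoc, hidem]
    exact hfix
  | succ m =>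
    obtain ⟨v, hv⟩ := exists_iterate_eq_iterate_mul h x 0 m
    rw [Nat.zero_add] at hv
    exact ⟨_, w * w, v, hidem, hv.trans (congrArg (· * v) hfix)⟩

/-- If distinct mutually regular idempotents never share a unit, then the local submonoid at an
idempotent `f` is commutative. -/
theorem local_comm {S : Type u} [Semigroup S]
    (hxyx : ∀ x y : S, x * y * x = x * y * x * y * x)
    (hb : ¬ ∃ e i f : S, e * e = e ∧ i * i = i ∧ e ≠ i ∧
        e * i * e = e ∧ i * e * i = i ∧
        f * f = f ∧ e * f = e ∧ f * e = e ∧ i * f = i ∧ f * i = i)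
    {f p q : S} (hf : f * f = f) (hpl : f * p = p) (hpr : p * f = p)
    (hql : f * q = q) (hqr : q * f = q) : p * q = q * p := by
  have idem : ∀ a : S, f * a = a → a * f = a → a * a = a := by
    intro a hl hr
    have := hxyx f a
    simp only [hl, hr, mul_assoc] at this
    exact this.symm
  have hp := idem p hpl hpr
  have hq := idem q hql hqr
  have lpq : f * (p * q) = p * q := by rw [← mul_assoc, hpl]
  have rpq : p * q * f = p * q := by rw [mul_assoc, hqr]
  have lqp : f * (q * p) = q * p := by rw [← mul_assoc, hql]
  have rqp : q * p * f = q * p := by rw [mul_assoc, hpr]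
  have hpq := idem _ lpq rpq
  have hqp := idem _ lqp rqp
  have sandwich : ∀ a b : S, a * a = a → b * b = b → a * b * (a * b) = a * b →
      a * b * (b * a) * (a * b) = a * b := by
    intro a b ha hb hab
    calc a * b * (b * a) * (a * b) = a * (b * b) * (a * a) * b := by simp only [mul_assoc]
      _ = a * b * (a * b) := by rw [ha, hb]; simp only [mul_assoc]
      _ = a * b := hab
  by_contra hne
  exact hb ⟨p * q, q * p, f, hpq, hqp, hne, sandwich p q hp hq hpq, sandwich q p hq hp hqp,
    hf, rpq, lpq, rqp, lqp⟩

/-- Lemma 3: in a finite semigroup with `S² = S` satisfying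
`x² = x³` and `xyx = xyxyx`, the identity `xyxzx = xzxyx` holds iff there are
no two distinct idempotents `e`, `i` with `eie = e`, `iei = i` having a common
unit `f`. -/
theorem stmt3 {S : Type u} [Semigroup S] [Finite S]
    (hS2 : SPow S 2 = Set.univ)
    (hxx : ∀ x : S, x * x = x * x * x)
    (hxyx : ∀ x y : S, x * y * x = x * y * x * y * x) :
    (∀ x y z : S, x * y * x * z * x = x * z * x * y * x) ↔
      ¬ ∃ e i f : S, e * e = e ∧ i * i = i ∧ e ≠ i ∧
        e * i * e = e ∧ i * e * i = i ∧
        f * f = f ∧ e * f = e ∧ f * e = e ∧ i * f = i ∧ f * i = i := by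
  constructor
  · rintro ha ⟨e, i, f, he, hi, hne, heie, hiei, -, hef, hfe, hif, hfi⟩
    have hcomm : e * i = i * e := by simpa only [hfe, hfi, hef, hif, mul_assoc] using ha f e i
    refine hne ?_
    calc e = e * i * e := heie.symm
      _ = i * e := by rw [hcomm, mul_assoc, he]
      _ = i * e * i := by rw [mul_assoc, hcomm, ← mul_assoc, hi]
      _ = i := hiei
  · intro hb x y z
    have hprod : ∀ x : S, ∃ a b : S, x = a * b := fun x =>
      exists_eq_mul_of_mem_SPow_two (hS2 ▸ Set.mem_univ x)
    obtain ⟨a, e, b, he, rfl⟩ : x ∈ SES S := SES_eq_univ hprod hxx ▸ Set.mem_univ x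
    have hl : ∀ t, e * (e * t * e) = e * t * e := fun t => by rw [← mul_assoc, ← mul_assoc, he]
    have hr : ∀ t, e * t * e * e = e * t * e := fun t => by rw [mul_assoc, he]
    have expand : ∀ s t : S, a * e * b * s * (a * e * b) * t * (a * e * b) =
        a * ((e * (b * s * a) * e) * (e * (b * t * a) * e)) * b := by
      intro s t
      calc _ = a * (e * (b * s * a) * e * (b * t * a) * e) * b := by simp only [mul_assoc]
        _ = a * (e * (b * s * a) * (e * e) * (b * t * a) * e) * b := by rw [he]
        _ = _ := by simp only [mul_assoc]
    rw [expand, expand, local_comm hxyx hb he (hl _) (hr _) (hl _) (hr _)]
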